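/- arXiv:0807.3590 — 7 statements merged into one kernel-verified Lean document; each statement's English description precedes it below -/
import Mathlib

section
/- Uniqueness–transversality equivalence for the positive orthant. Let A be an n×N real matrix and let x_0 ∈ ℝ^N satisfy x_0 ≥ 0 coordinatewise. Then the following are equivalent: (i) the only x ∈ ℝ^N with x ≥ 0 coordinatewise and Ax = Ax_0 is x = x_0; (ii) the only vector v in the kernel of A satisfying v_i ≥ 0 for every index i with x_0(i) = 0 is v = 0. -/
open Filter Topology in
/-- A direction that is nonnegative on the zero set of `x ≥ 0` is feasible for the orthant at `x`:
one can move from `x` a positive distance along it. -/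
theorem exists_pos_forall_add_smul_nonneg {ι : Type*} [Finite ι] {x v : ι → ℝ}
    (hx : ∀ i, 0 ≤ x i) (hv : ∀ i, x i = 0 → 0 ≤ v i) :
    ∃ t : ℝ, 0 < t ∧ ∀ i, 0 ≤ (x + t • v) i := by
  have h : ∀ᶠ t : ℝ in 𝓝[>] 0, ∀ i, 0 ≤ (x + t • v) i := by
    refine eventually_all.2 fun i => ?_
    rcases (hx i).eq_or_lt with h0 | hpos
    · filter_upwards [self_mem_nhdsWithin] with t ht
      simpa [← h0] using mul_nonneg (le_of_lt ht) (hv i h0.symm)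
    · have hc : Tendsto (fun t : ℝ => x i + t * v i) (𝓝 0) (𝓝 (x i)) :=
        Continuous.tendsto' (by fun_prop) _ _ (by simp)
      filter_upwards [nhdsWithin_le_nhds (hc.eventually_const_lt hpos)] with t ht
      simpa using ht.le
  exact (eventually_mem_nhdsWithin.and h).exists

/-- **Uniqueness–transversality equivalence for the positive orthant.**
For `A : n × N` real and `x₀ ≥ 0`, the system `Ax = Ax₀`, `x ≥ 0` has `x₀` as
its unique solution iff the only kernel vector `v` of `A` with `v i ≥ 0`
whenever `x₀ i = 0` is `v = 0`. -/
theorem orthant_unique_iff_transverse (n N : ℕ)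
    (A : Matrix (Fin n) (Fin N) ℝ) (x0 : Fin N → ℝ) (hx0 : ∀ i, 0 ≤ x0 i) :
    (∀ x : Fin N → ℝ, (∀ i, 0 ≤ x i) → A.mulVec x = A.mulVec x0 → x = x0) ↔
      (∀ v : Fin N → ℝ, A.mulVec v = 0 →
        (∀ i, x0 i = 0 → 0 ≤ v i) → v = 0) := by
  constructor
  · intro h v hAv hv
    obtain ⟨t, ht, hnonneg⟩ := exists_pos_forall_add_smul_nonneg hx0 hv
    have hfix := h (x0 + t • v) hnonneg (by
      rw [Matrix.mulVec_add, Matrix.mulVec_smul, hAv, smul_zero, add_zero])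
    exact (smul_eq_zero.1 (add_eq_left.1 hfix)).resolve_left ht.ne'
  · intro h x hx hAx
    refine sub_eq_zero.1 (h (x - x0) ?_ fun i hi => ?_)
    · rw [Matrix.mulVec_sub, hAx, sub_self]
    · simpa [hi] using hx i
end

section
/- Uniqueness–transversality equivalence for the hypercube. Let A be an n×N real matrix and let x_0 ∈ ℝ^N satisfy 0 ≤ x_0(i) ≤ 1 for all i. Then the following are equivalent: (i) the only x ∈ ℝ^N with 0 ≤ x(i) ≤ 1 for all i and Ax = Ax_0 is x = x_0; (ii) the only vector v in the kernel of A satisfying v_i ≥ 0 for every index i with x_0(i) = 0 and v_i ≤ 0 for every index i with x_0(i) = 1 is v = 0. -/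
open Filter Topology in
/-- A nonnegative real stays nonnegative under small positive steps in a direction that is
feasible for the half-line `[0, ∞)`. -/
theorem eventually_nonneg_add_mul {a w : ℝ} (ha : 0 ≤ a) (hw : a = 0 → 0 ≤ w) :
    ∀ᶠ t in 𝓝[>] (0 : ℝ), 0 ≤ a + t * w := by
  rcases ha.eq_or_lt with rfl | ha
  · filter_upwards [self_mem_nhdsWithin] with t ht
    simpa using mul_nonneg (le_of_lt ht) (hw rfl)
  · have hc : Tendsto (fun t : ℝ => a + t * w) (𝓝 0) (𝓝 a) := by
      have : Continuous fun t : ℝ => a + t * w := by fun_prop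
      simpa using this.tendsto 0
    exact ((hc.mono_left nhdsWithin_le_nhds).eventually_const_lt ha).mono fun _ h => h.le

/-- **Uniqueness–transversality equivalence for the hypercube.**
For `A : n × N` real and `x₀` in the hypercube `[0,1]^N`, the system `Ax = Ax₀`,
`0 ≤ x ≤ 1` has `x₀` as its unique solution iff the only kernel vector `v` of `A`
with `v i ≥ 0` whenever `x₀ i = 0` and `v i ≤ 0` whenever `x₀ i = 1` is `v = 0`. -/
theorem hypercube_unique_iff_transverse (n N : ℕ)
    (A : Matrix (Fin n) (Fin N) ℝ) (x0 : Fin N → ℝ)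
    (hx0 : ∀ i, 0 ≤ x0 i ∧ x0 i ≤ 1) :
    (∀ x : Fin N → ℝ, (∀ i, 0 ≤ x i ∧ x i ≤ 1) →
        A.mulVec x = A.mulVec x0 → x = x0) ↔
      (∀ v : Fin N → ℝ, A.mulVec v = 0 →
        (∀ i, x0 i = 0 → 0 ≤ v i) → (∀ i, x0 i = 1 → v i ≤ 0) → v = 0) := by
  constructor
  · intro hunique v hv hlow hupp
    have hlow' : ∀ᶠ t in nhdsWithin (0 : ℝ) (Set.Ioi 0), ∀ i, 0 ≤ x0 i + t * v i :=
      Filter.eventually_all.2 fun i => eventually_nonneg_add_mul (hx0 i).1 (hlow i)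
    have hupp' : ∀ᶠ t in nhdsWithin (0 : ℝ) (Set.Ioi 0), ∀ i, 0 ≤ (1 - x0 i) + t * (-v i) :=
      Filter.eventually_all.2 fun i =>
        eventually_nonneg_add_mul (sub_nonneg.2 (hx0 i).2) fun h =>
          neg_nonneg.2 (hupp i (by linarith))
    obtain ⟨t, ⟨hl, hu⟩, ht⟩ := ((hlow'.and hupp').and self_mem_nhdsWithin).exists
    have hx : x0 + t • v = x0 := by
      refine hunique _ (fun i => ⟨hl i, ?_⟩) ?_
      · have := hu i
        simp only [Pi.add_apply, Pi.smul_apply, smul_eq_mul]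
        linarith
      · rw [Matrix.mulVec_add, Matrix.mulVec_smul, hv, smul_zero, add_zero]
    exact (smul_eq_zero.1 (add_eq_left.1 hx)).resolve_left (ne_of_gt ht)
  · intro htrans x hx hAx
    refine sub_eq_zero.1 (htrans (x - x0) ?_ ?_ ?_)
    · rw [Matrix.mulVec_sub, hAx, sub_self]
    · intro i hi
      simpa [hi] using (hx i).1
    · intro i hi
      simpa [hi] using (hx i).2
end

section
/- Projected hypercubes always lose vertices. Let n < N be positive integers and let A be any n×N real matrix, regarded as a linear map from ℝ^N to ℝ^n. Then the set of extreme points of the image A([0,1]^N) of the hypercube is finite and has cardinality strictly less than 2^N. -/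
/-- The vertices of the unit cube, indexed by Boolean vectors. -/
def cubeVertex {ι : Type*} (s : ι → Bool) (i : ι) : ℝ := if s i then 1 else 0

theorem unitCube_eq_convexHull_range_cubeVertex {ι : Type*} [Finite ι] :
    {x : ι → ℝ | ∀ i, 0 ≤ x i ∧ x i ≤ 1} = convexHull ℝ (Set.range (cubeVertex (ι := ι))) := by
  have h : Set.range (cubeVertex (ι := ι)) = Set.univ.pi fun _ => ({0, 1} : Set ℝ) := by
    ext x
    simp only [Set.mem_range, Set.mem_pi, Set.mem_univ, true_imp_iff, Set.mem_insert_iff,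
      Set.mem_singleton_iff]
    constructor
    · rintro ⟨s, rfl⟩ i
      unfold cubeVertex
      split_ifs <;> simp
    · intro hx
      refine ⟨fun i => decide (x i = 1), funext fun i => ?_⟩
      rcases hx i with h | h <;> simp [cubeVertex, h]
  rw [h, convexHull_pi]
  ext x
  simp [convexHull_pair, segment_eq_Icc, Pi.le_def, forall_and]

theorem extremePoints_image_unitCube_subset {ι E : Type*} [Finite ι] [AddCommGroup E] [Module ℝ E]
    (f : (ι → ℝ) →ₗ[ℝ] E) :
    Set.extremePoints ℝ (f '' {x : ι → ℝ | ∀ i, 0 ≤ x i ∧ x i ≤ 1}) ⊆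
      Set.range fun s => f (cubeVertex s) := by
  rw [unitCube_eq_convexHull_range_cubeVertex, f.image_convexHull, ← Set.range_comp]
  exact extremePoints_convexHull_subset

/-- If a linear map has a nontrivial kernel, then it identifies two vertices of the unit cube
or sends some vertex to a point that is not extreme in the image. -/
theorem exists_cubeVertex_notMem_extremePoints {ι E : Type*} [Fintype ι] [AddCommGroup E]
    [Module ℝ E] (f : (ι → ℝ) →ₗ[ℝ] E) (hf : LinearMap.ker f ≠ ⊥)
    (hinj : Function.Injective fun s => f (cubeVertex s)) :
    ∃ s, f (cubeVertex s) ∉ Set.extremePoints ℝ (f '' {x : ι → ℝ | ∀ i, 0 ≤ x i ∧ x i ≤ 1}) := by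
  classical
  obtain ⟨u, hu, hu0⟩ := (Submodule.ne_bot_iff _).1 hf
  obtain ⟨v, hv, hv0, hle⟩ : ∃ v : ι → ℝ, f v = 0 ∧ v ≠ 0 ∧ ∀ i, |v i| ≤ 1 / 2 := by
    have hpos : 0 < ‖u‖ := norm_pos_iff.2 hu0
    refine ⟨(1 / (2 * ‖u‖)) • u, by simp [LinearMap.mem_ker.1 hu], ?_, fun i => ?_⟩
    · exact smul_ne_zero (by positivity) hu0
    · rw [Pi.smul_apply, smul_eq_mul, abs_mul, abs_of_pos (by positivity), div_mul_eq_mul_div,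
        one_mul, div_le_div_iff₀ (by positivity) (by norm_num)]
      have := norm_le_pi_norm u i
      rw [Real.norm_eq_abs] at this
      linarith
  obtain ⟨i, hi⟩ := Function.ne_iff.1 hv0
  let s : ι → Bool := fun j => decide (0 < v j)
  have hx : ∀ j, (cubeVertex s - v) j = if 0 < v j then 1 - |v j| else |v j| := by
    intro j
    by_cases h : 0 < v j
    · simp [cubeVertex, s, h, abs_of_pos h]
    · simp [cubeVertex, s, h, abs_of_nonpos (not_lt.1 h)]
  have hmem : ∀ c : ℝ, |c| ≤ 1 → ∀ j,
      0 ≤ (cubeVertex s - v + Pi.single i (c * |v i|) : ι → ℝ) j ∧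
        (cubeVertex s - v + Pi.single i (c * |v i|) : ι → ℝ) j ≤ 1 := by
    intro c hc j
    have h0 := abs_nonneg (v j)
    have h1 := hle j
    have hc' := abs_le.1 hc
    rw [Pi.add_apply, hx]
    by_cases hj : j = i
    · subst hj
      rw [Pi.single_eq_same]
      split_ifs <;> constructor <;> nlinarith
    · rw [Pi.single_eq_of_ne hj]
      split_ifs <;> constructor <;> linarith
  refine ⟨s, fun hs => ?_⟩
  have hseg : f (cubeVertex s) ∈ openSegment ℝ
      (f (cubeVertex s - v + Pi.single i (1 * |v i|)))
      (f (cubeVertex s - v + Pi.single i (-1 * |v i|))) := by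
    refine ⟨1 / 2, 1 / 2, by norm_num, by norm_num, by norm_num, ?_⟩
    rw [neg_one_mul, one_mul, Pi.single_neg]
    simp only [map_add, map_sub, map_neg, hv]
    module
  have heq := hs.2 ⟨_, hmem 1 (by simp), rfl⟩ ⟨_, hmem (-1) (by simp), rfl⟩ hseg
  have hker : f (Pi.single i 1) = 0 := by
    have h : |v i| • f (Pi.single i 1) = 0 := by
      rw [← map_smul, ← Pi.single_smul, smul_eq_mul, mul_one]
      simpa [hv] using heq
    exact (smul_eq_zero.1 h).resolve_left (abs_ne_zero.2 hi)
  have hflip : cubeVertex (Function.update s i true) =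
      cubeVertex (Function.update s i false) + Pi.single i 1 := by
    ext j
    by_cases hj : j = i
    · subst hj
      simp [cubeVertex]
    · simp [cubeVertex, hj]
  have hup := @hinj (Function.update s i true) (Function.update s i false)
    (by simp only [hflip, map_add, hker, add_zero])
  simpa using congrFun hup i

/-- **Projected hypercubes always lose vertices.** For any `n × N` real matrix `A`
with `n < N`, the set of extreme points of the image `A([0,1]^N)` of the hypercube
is finite and has strictly fewer than `2^N` elements. -/
theorem projected_hypercube_loses_vertices (n N : ℕ) (hn : 0 < n) (hnN : n < N)
    (A : Matrix (Fin n) (Fin N) ℝ) :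
    (Set.extremePoints ℝ
        (A.mulVec '' {x : Fin N → ℝ | ∀ i, 0 ≤ x i ∧ x i ≤ 1})).Finite ∧
      (Set.extremePoints ℝ
        (A.mulVec '' {x : Fin N → ℝ | ∀ i, 0 ≤ x i ∧ x i ≤ 1})).ncard < 2 ^ N := by
  have hsub := extremePoints_image_unitCube_subset A.mulVecLin
  have hcard : Nat.card (Fin N → Bool) = 2 ^ N := by simp
  have hfin := Set.finite_range fun s : Fin N → Bool => A.mulVecLin (cubeVertex s)
  refine ⟨hfin.subset hsub, ?_⟩
  by_contra! hge
  have hrange : (Set.range fun s : Fin N → Bool => A.mulVecLin (cubeVertex s)).ncard ≤ 2 ^ N := by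
    rw [← Set.image_univ, ← hcard, ← Set.ncard_univ]
    exact Set.ncard_image_le
  have heq := Set.eq_of_subset_of_ncard_le hsub (hrange.trans hge) hfin
  have hinj : Function.Injective fun s : Fin N → Bool => A.mulVecLin (cubeVertex s) := by
    rw [← Set.injOn_univ]
    refine Set.injOn_of_ncard_image_eq (le_antisymm Set.ncard_image_le ?_)
    rw [Set.image_univ, ← heq, Set.ncard_univ, hcard]
    exact hge
  obtain ⟨s, hs⟩ := exists_cubeVertex_notMem_extremePoints A.mulVecLin
    (LinearMap.ker_ne_bot_of_finrank_lt (by simpa using hnN)) hinj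
  exact hs (heq ▸ Set.mem_range_self s)
end

section
/- Strong threshold for the orthant. Let δ ∈ (1/2, 1) and ρ ∈ (0, 1) satisfy ρ < 2 − δ^{-1} and ψ_S(δ, ρ) < 0. Let (k_n) and (N_n) be sequences of integers with 0 < k_n < n < N_n, k_n/n → ρ and n/N_n → δ as n → ∞, and for each n let A_n be a random n×N_n real matrix with an orthant-symmetric generic nullspace. Then the probability of the event {for every x_0 ∈ ℝ^{N_n} with x_0 ≥ 0 coordinatewise and at most k_n nonzero entries, the only x ∈ ℝ^{N_n} with x ≥ 0 coordinatewise and A_n x = A_n x_0 is x = x_0} tends to 1 as n → ∞. -/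
open MeasureTheory Filter

/-- The base-`e` Shannon entropy `H(γ) = -γ log γ - (1-γ) log (1-γ)`
(with the conventions `H(0) = H(1) = 0`, since `Real.log 0 = 0`). -/
noncomputable def shannonH (γ : ℝ) : ℝ :=
  -γ * Real.log γ - (1 - γ) * Real.log (1 - γ)

/-- The strong exponent `ψ_S(δ,ρ) = H(δ) + δ H(ρ) - (1 - ρδ) log 2`. -/
noncomputable def psiS (δ ρ : ℝ) : ℝ :=
  shannonH δ + δ * shannonH ρ - (1 - ρ * δ) * Real.log 2

instance matrixMeasurableSpace {n N : ℕ} :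
    MeasurableSpace (Matrix (Fin n) (Fin N) ℝ) :=
  (inferInstance : MeasurableSpace (Fin n → Fin N → ℝ))

/-- A random `n × N` real matrix (i.e. a probability measure on matrices) has an
orthant-symmetric generic nullspace when (i) its distribution is invariant under
right multiplication by any `±1` diagonal matrix, and (ii) almost surely it has
rank `n` and every nonzero kernel vector has at least `n + 1` nonzero coordinates. -/
def OrthantSymmetricGeneric {n N : ℕ}
    (μ : Measure (Matrix (Fin n) (Fin N) ℝ)) : Prop :=
  (∀ s : Fin N → ℝ, (∀ j, s j = 1 ∨ s j = -1) →
    μ.map (fun A => A * Matrix.diagonal s) = μ) ∧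
  μ {A | A.rank = n ∧ ∀ v : Fin N → ℝ, A.mulVec v = 0 → v ≠ 0 →
      n + 1 ≤ {i | v i ≠ 0}.ncard} = 1

/-- A matrix all of whose maximal minors are nonzero. -/
def MaximalMinorsNeZero {n N : ℕ} (A : Matrix (Fin n) (Fin N) ℝ) : Prop :=
  ∀ f : Fin n → Fin N, Function.Injective f → (A.submatrix id f).det ≠ 0

/-- Matrices with a nonzero kernel vector that is nonnegative off `K`. -/
def nonnegKernelOff {n N : ℕ} (K : Finset (Fin N)) : Set (Matrix (Fin n) (Fin N) ℝ) :=
  {A | ∃ v, v ≠ 0 ∧ A.mulVec v = 0 ∧ ∀ i ∉ K, 0 ≤ v i}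

/-- The `±1` vector that is `1` exactly on `S`. -/
noncomputable def signVec {N : ℕ} (S : Finset (Fin N)) (j : Fin N) : ℝ :=
  if j ∈ S then 1 else -1

lemma submatrix_mulVec_eq {n N : ℕ} (A : Matrix (Fin n) (Fin N) ℝ) {f : Fin n → Fin N}
    (hf : Function.Injective f) (v : Fin N → ℝ) (hv : ∀ j ∉ Set.range f, v j = 0) :
    (A.submatrix id f).mulVec (v ∘ f) = A.mulVec v := by
  ext i
  change ∑ l, A i (f l) * v (f l) = ∑ j, A i j * v j
  refine Finset.sum_of_injOn f hf.injOn (fun _ _ => Finset.mem_coe.2 (Finset.mem_univ _))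
    (fun j _ hj => ?_) (fun _ _ => rfl)
  simp [hv j (by simpa using hj)]

lemma maximalMinorsNeZero_of_generic {n N : ℕ} {A : Matrix (Fin n) (Fin N) ℝ}
    (h : ∀ v : Fin N → ℝ, A.mulVec v = 0 → v ≠ 0 → n + 1 ≤ {i | v i ≠ 0}.ncard) :
    MaximalMinorsNeZero A := by
  intro f hf hdet
  obtain ⟨u, hu0, hu⟩ := Matrix.exists_mulVec_eq_zero_iff.2 hdet
  let v : Fin N → ℝ := Function.extend f u 0
  have hcomp : v ∘ f = u := Function.extend_comp hf u 0
  have hoff : ∀ j ∉ Set.range f, v j = 0 := fun j hj =>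
    Function.extend_apply' u (0 : Fin N → ℝ) j hj
  have hker : A.mulVec (v) = 0 := by
    rw [← submatrix_mulVec_eq A hf _ hoff, hcomp, hu]
  have hne : v ≠ 0 := by
    intro h0
    rw [h0] at hcomp
    exact hu0 hcomp.symm
  have hle : {i | v i ≠ 0}.ncard ≤ (Set.range f).ncard :=
    Set.ncard_le_ncard (fun j hj => by_contra fun hj' => hj (hoff j hj')) (Set.toFinite _)
  have hcard : (Set.range f).ncard = n := by
    rw [← Set.image_univ, Set.ncard_image_of_injective _ hf, Set.ncard_univ, Nat.card_fin]
  have := h _ hker hne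
  omega

lemma MaximalMinorsNeZero.eq_zero_of_mulVec {n N : ℕ} {A : Matrix (Fin n) (Fin N) ℝ}
    (hA : MaximalMinorsNeZero A) {U : Finset (Fin N)} (hU : U.card = n) {v : Fin N → ℝ}
    (hv : A.mulVec v = 0) (hoff : ∀ j ∉ U, v j = 0) : v = 0 := by
  set f := U.orderEmbOfFin hU
  have hr : Set.range f = U := U.range_orderEmbOfFin hU
  by_contra hne
  refine hA f f.injective (Matrix.exists_mulVec_eq_zero_iff.1 ⟨v ∘ f, ?_, ?_⟩)
  · intro h0
    refine hne (funext fun j => ?_)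
    by_cases hj : j ∈ U
    · obtain ⟨l, rfl⟩ : j ∈ Set.range f := by rw [hr]; exact hj
      exact congrFun h0 l
    · exact hoff j hj
  · rw [submatrix_mulVec_eq A f.injective v (by rw [hr]; exact hoff), hv]

lemma MaximalMinorsNeZero.eq_zero_of_vecMul {n N : ℕ} {A : Matrix (Fin n) (Fin N) ℝ}
    (hA : MaximalMinorsNeZero A) {U : Finset (Fin N)} (hU : U.card = n) {y : Fin n → ℝ}
    (hy : ∀ j ∈ U, A.vecMul y j = 0) : y = 0 := by
  by_contra hne
  refine hA (U.orderEmbOfFin hU) (U.orderEmbOfFin hU).injective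
    (Matrix.exists_vecMul_eq_zero_iff.1 ⟨y, hne, funext fun l => ?_⟩)
  exact hy _ (U.orderEmbOfFin_mem hU l)

lemma exists_vecMul_eq_zero_on {n N : ℕ} (A : Matrix (Fin n) (Fin N) ℝ) {V : Finset (Fin N)}
    (hV : V.card < n) : ∃ y ≠ 0, ∀ j ∈ V, A.vecMul y j = 0 := by
  have hker := LinearMap.ker_ne_bot_of_finrank_lt
    (f := (LinearMap.funLeft ℝ ℝ ((↑) : V → Fin N)).comp A.vecMulLinear) (by simpa using hV)
  obtain ⟨y, hy, hy0⟩ := Submodule.exists_mem_ne_zero_of_ne_bot hker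
  exact ⟨y, hy0, fun j hj => congrFun (LinearMap.mem_ker.1 hy) ⟨j, hj⟩⟩

/-- Sets shattered by the sign patterns of a generic kernel have at most `N - n` elements. -/
lemma MaximalMinorsNeZero.card_le_of_shatters {n N : ℕ} {A : Matrix (Fin n) (Fin N) ℝ}
    (hA : MaximalMinorsNeZero A) (hnN : n ≤ N) {T : Finset (Fin N)} {F : Finset (Finset (Fin N))}
    (hT : F.Shatters T)
    (hF : ∀ S ∈ F, ∃ v, v ≠ 0 ∧ A.mulVec v = 0 ∧ ∀ i ∈ T, 0 ≤ signVec S i * v i) :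
    T.card ≤ N - n := by
  by_contra! hlt
  obtain ⟨T', hT', hcard⟩ := Finset.exists_subset_card_eq (Nat.succ_le_of_lt hlt)
  have hTN : T'.card ≤ N := by simpa using Finset.card_le_univ T'
  have hcompl : T'ᶜ.card = N - T'.card := by simp [Finset.card_compl]
  obtain ⟨y, hy0, hy⟩ := exists_vecMul_eq_zero_on A (V := T'ᶜ) (by omega)
  have hins : ∀ j ∈ T', (insert j T'ᶜ).card = n := by
    intro j hj
    rw [Finset.card_insert_of_notMem (by simpa using hj)]
    omega
  have hw : ∀ j ∈ T', A.vecMul y j ≠ 0 := by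
    intro j hj hj0
    refine hy0 (hA.eq_zero_of_vecMul (hins j hj) fun l hl => ?_)
    rcases Finset.mem_insert.1 hl with rfl | hl
    exacts [hj0, hy l hl]
  obtain ⟨S, hS, hST⟩ := hT.mono_right hT' (Finset.filter_subset (fun j => 0 < A.vecMul y j) T')
  obtain ⟨v, hv0, hv, hsgn⟩ := hF S hS
  have hmem : ∀ j ∈ T', (j ∈ S ↔ 0 < A.vecMul y j) := by
    intro j hj
    have := Finset.ext_iff.1 hST j
    simpa [hj] using this
  have hnonneg : ∀ j, 0 ≤ A.vecMul y j * v j := by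
    intro j
    by_cases hj : j ∈ T'
    · have h1 := hsgn j (hT' hj)
      have h2 := hmem j hj
      unfold signVec at h1
      split_ifs at h1 with hjS
      · exact mul_nonneg (h2.1 hjS).le (by linarith)
      · exact mul_nonneg_of_nonpos_of_nonpos (not_lt.1 fun h => hjS (h2.2 h)) (by linarith)
    · rw [hy j (by simpa using hj), zero_mul]
  have hsum : ∑ j, A.vecMul y j * v j = 0 := by
    have := Matrix.dotProduct_mulVec y A v
    rw [hv, dotProduct_zero] at this
    exact this.symm
  have hvT : ∀ j ∈ T', v j = 0 := by
    intro j hj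
    have := (Finset.sum_eq_zero_iff_of_nonneg fun j _ => hnonneg j).1 hsum j (Finset.mem_univ j)
    exact (mul_eq_zero.1 this).resolve_left (hw j hj)
  obtain ⟨j, hj⟩ : T'.Nonempty := Finset.card_pos.1 (by omega)
  refine hv0 (hA.eq_zero_of_mulVec (hins j hj) hv fun l hl => hvT l ?_)
  simp only [Finset.mem_insert, Finset.mem_compl, not_or, not_not] at hl
  exact hl.2

open Classical in
/-- Signed copies of the kernel cone event occurring simultaneously off `K`. -/
lemma MaximalMinorsNeZero.card_sign_patterns_le {n N : ℕ} {A : Matrix (Fin n) (Fin N) ℝ}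
    (hA : MaximalMinorsNeZero A) (hnN : n ≤ N) (K : Finset (Fin N)) :
    (Kᶜ.powerset.filter fun S => A * Matrix.diagonal (signVec S) ∈ nonnegKernelOff K).card ≤
      ∑ i ∈ Finset.range (N - n + 1), Kᶜ.card.choose i := by
  set F := Kᶜ.powerset.filter fun S => A * Matrix.diagonal (signVec S) ∈ nonnegKernelOff K
  have hsub : F.shatterer ⊆
      (Finset.range (N - n + 1)).biUnion fun i => Kᶜ.powersetCard i := by
    intro T hT
    rw [Finset.mem_shatterer] at hT
    have hTK : T ⊆ Kᶜ := by
      obtain ⟨S, hS, hTS⟩ := hT.exists_superset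
      exact hTS.trans (Finset.mem_powerset.1 (Finset.mem_filter.1 hS).1)
    have hcard : T.card ≤ N - n := by
      refine hA.card_le_of_shatters hnN hT fun S hS => ?_
      obtain ⟨v, hv0, hv, hpos⟩ := (Finset.mem_filter.1 hS).2
      have hsq : ∀ j, signVec S j * signVec S j = 1 := by
        intro j; unfold signVec; split_ifs <;> norm_num
      refine ⟨fun j => signVec S j * v j, fun h0 => hv0 (funext fun j => ?_), ?_, fun i hi => ?_⟩
      · have := congrFun h0 j
        have h1 := hsq j
        simp only [Pi.zero_apply] at this
        simpa [← mul_assoc, h1] using congrArg (signVec S j * ·) this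
      · rw [← hv, ← Matrix.mulVec_mulVec]
        congr 1
        ext j
        rw [Matrix.mulVec_diagonal]
      · rw [← mul_assoc, hsq, one_mul]
        exact hpos i (by simpa using hTK hi)
    simp only [Finset.mem_biUnion, Finset.mem_range, Finset.mem_powersetCard]
    exact ⟨T.card, by omega, hTK, rfl⟩
  calc F.card ≤ F.shatterer.card := F.card_le_card_shatterer
    _ ≤ _ := Finset.card_le_card hsub
    _ ≤ _ := Finset.card_biUnion_le
    _ = _ := by simp only [Finset.card_powersetCard]

instance matrixBorelSpace {n N : ℕ} : BorelSpace (Matrix (Fin n) (Fin N) ℝ) :=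
  inferInstanceAs (BorelSpace (Fin n → Fin N → ℝ))

lemma measurableSet_maximalMinorsNeZero {n N : ℕ} :
    MeasurableSet {A : Matrix (Fin n) (Fin N) ℝ | MaximalMinorsNeZero A} := by
  simp only [MaximalMinorsNeZero, Set.ofPred_forall]
  refine MeasurableSet.iInter fun f => MeasurableSet.iInter fun _ => ?_
  refine IsOpen.measurableSet (isOpen_ne_fun ?_ continuous_const)
  exact (continuous_id.matrix_submatrix id f).matrix_det

lemma measurableSet_nonnegKernelOff {n N : ℕ} (K : Finset (Fin N)) :
    MeasurableSet (nonnegKernelOff K : Set (Matrix (Fin n) (Fin N) ℝ)) := by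
  let C : Set (Metric.sphere (0 : Fin N → ℝ) 1 × Matrix (Fin n) (Fin N) ℝ) :=
    {p | p.2.mulVec p.1 = 0 ∧ ∀ i ∉ K, 0 ≤ (p.1 : Fin N → ℝ) i}
  have hC : IsClosed C := by
    have hCeq : C = {p | p.2.mulVec p.1 = 0} ∩ ⋂ i, ⋂ _ : i ∉ K, {p | 0 ≤ (p.1 : Fin N → ℝ) i} := by
      ext p
      simp [C]
    rw [hCeq]
    refine IsClosed.inter (isClosed_eq ?_ continuous_const)
      (isClosed_iInter fun i => isClosed_iInter fun _ => isClosed_le continuous_const ?_)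
    · exact continuous_snd.matrix_mulVec (continuous_subtype_val.comp continuous_fst)
    · exact (continuous_apply i).comp (continuous_subtype_val.comp continuous_fst)
  have himage : (nonnegKernelOff K : Set (Matrix (Fin n) (Fin N) ℝ)) = Prod.snd '' C := by
    ext A
    constructor
    · rintro ⟨v, hv0, hv, hpos⟩
      refine ⟨(⟨‖v‖⁻¹ • v, by simp [norm_smul, hv0]⟩, A), ⟨?_, fun i hi => ?_⟩, rfl⟩
      · simp [Matrix.mulVec_smul, hv]
      · exact mul_nonneg (by positivity) (hpos i hi)
    · rintro ⟨⟨v, B⟩, ⟨hv, hpos⟩, rfl⟩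
      exact ⟨v, ne_zero_of_mem_unit_sphere v, hv, hpos⟩
  rw [himage]
  exact (isClosedMap_snd_of_compactSpace C hC).measurableSet

open Classical in
lemma OrthantSymmetricGeneric.measure_nonnegKernelOff_le {n N : ℕ}
    {μ : Measure (Matrix (Fin n) (Fin N) ℝ)} [IsProbabilityMeasure μ]
    (hμ : OrthantSymmetricGeneric μ) (hnN : n ≤ N) (K : Finset (Fin N)) :
    2 ^ Kᶜ.card * μ (nonnegKernelOff K) ≤
      ((∑ i ∈ Finset.range (N - n + 1), Kᶜ.card.choose i : ℕ) : ENNReal) := by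
  obtain ⟨hsymm, hgen⟩ := hμ
  have hminors : ∀ᵐ A ∂μ, MaximalMinorsNeZero A := by
    have h1 : μ {A | MaximalMinorsNeZero A} = 1 := by
      refine le_antisymm prob_le_one (hgen ▸ measure_mono fun A hA => ?_)
      exact maximalMinorsNeZero_of_generic hA.2
    exact (mem_ae_iff_prob_eq_one measurableSet_maximalMinorsNeZero).2 h1
  let flip (S : Finset (Fin N)) (A : Matrix (Fin n) (Fin N) ℝ) : Matrix (Fin n) (Fin N) ℝ :=
    A * Matrix.diagonal (signVec S)
  let E (S : Finset (Fin N)) : Set (Matrix (Fin n) (Fin N) ℝ) :=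
    flip S ⁻¹' nonnegKernelOff K
  have hmeas : ∀ S, Measurable (flip S) := fun S =>
    Continuous.measurable (Continuous.matrix_mul continuous_id continuous_const)
  have hE : ∀ S, MeasurableSet (E S) := fun S => hmeas S (measurableSet_nonnegKernelOff K)
  have hμE : ∀ S, μ (E S) = μ (nonnegKernelOff K) := by
    intro S
    have hmap : μ.map (flip S) = μ := hsymm (signVec S) fun j => by
      unfold signVec
      split_ifs <;> simp
    conv_rhs => rw [← hmap, Measure.map_apply (hmeas S) (measurableSet_nonnegKernelOff K)]
  calc 2 ^ Kᶜ.card * μ (nonnegKernelOff K)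
      = ∑ S ∈ Kᶜ.powerset, μ (E S) := by
        simp [hμE, Finset.card_powerset]
    _ = ∫⁻ A, ∑ S ∈ Kᶜ.powerset, (E S).indicator 1 A ∂μ := by
        rw [lintegral_finsetSum _ fun S _ => measurable_one.indicator (hE S)]
        simp_rw [lintegral_indicator_one (hE _)]
    _ ≤ ∫⁻ _, ((∑ i ∈ Finset.range (N - n + 1), Kᶜ.card.choose i : ℕ) : ENNReal) ∂μ := by
        refine lintegral_mono_ae (hminors.mono fun A hA => ?_)
        have hcard := hA.card_sign_patterns_le hnN K
        rw [Finset.card_filter] at hcard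
        refine le_trans (le_of_eq ?_) (Nat.cast_le.2 hcard)
        push_cast
        exact Finset.sum_congr rfl fun S _ => by simp [Set.indicator_apply, E, flip]
    _ = _ := by simp

/-- The event that every nonnegative `k`-sparse vector is determined by its image among
nonnegative vectors. -/
def nonnegUniqueness (n N k : ℕ) : Set (Matrix (Fin n) (Fin N) ℝ) :=
  {A | ∀ x0 : Fin N → ℝ, (∀ i, 0 ≤ x0 i) → {i | x0 i ≠ 0}.ncard ≤ k →
    ∀ x : Fin N → ℝ, (∀ i, 0 ≤ x i) → A.mulVec x = A.mulVec x0 → x = x0}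

lemma compl_nonnegUniqueness_subset {n N k : ℕ} (hk : k ≤ N) :
    (nonnegUniqueness n N k)ᶜ ⊆
      ⋃ K ∈ (Finset.univ : Finset (Fin N)).powersetCard k, nonnegKernelOff K := by
  intro A hA
  simp only [nonnegUniqueness, Set.mem_compl_iff, Set.mem_ofPred_eq, not_forall] at hA
  obtain ⟨x0, -, hcard, x, hx, hAx, hne⟩ := hA
  rw [Set.ncard_eq_toFinset_card'] at hcard
  obtain ⟨K, hsub, hK⟩ := Finset.exists_superset_card_eq hcard (by simpa using hk)
  simp only [Set.mem_iUnion, Finset.mem_powersetCard]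
  refine ⟨K, ⟨Finset.subset_univ K, hK⟩, x - x0, sub_ne_zero.2 hne, ?_, fun i hi => ?_⟩
  · rw [Matrix.mulVec_sub, hAx, sub_self]
  · have : x0 i = 0 := by
      by_contra h
      exact hi (hsub (by simpa using h))
    simpa [this] using hx i

lemma OrthantSymmetricGeneric.measure_compl_nonnegUniqueness_le {n N k : ℕ}
    {μ : Measure (Matrix (Fin n) (Fin N) ℝ)} [IsProbabilityMeasure μ]
    (hμ : OrthantSymmetricGeneric μ) (hk : k ≤ N) (hnN : n ≤ N) :
    μ.real (nonnegUniqueness n N k)ᶜ ≤ (N.choose k : ℝ) *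
      ((∑ i ∈ Finset.range (N - n + 1), ((N - k).choose i : ℝ)) / 2 ^ (N - k)) := by
  have hK : ∀ K ∈ (Finset.univ : Finset (Fin N)).powersetCard k,
      μ.real (nonnegKernelOff K) ≤
        (∑ i ∈ Finset.range (N - n + 1), ((N - k).choose i : ℝ)) / 2 ^ (N - k) := by
    intro K hK
    have hcard : Kᶜ.card = N - k := by
      rw [Finset.card_compl, Fintype.card_fin, (Finset.mem_powersetCard.1 hK).2]
    have h := ENNReal.toReal_mono (ENNReal.natCast_ne_top _)
      (hμ.measure_nonnegKernelOff_le hnN K)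
    rw [hcard] at h
    rw [le_div_iff₀ (by positivity), mul_comm]
    rw [ENNReal.toReal_mul, ENNReal.toReal_natCast] at h
    simpa [Measure.real] using h
  calc μ.real (nonnegUniqueness n N k)ᶜ
      ≤ μ.real (⋃ K ∈ (Finset.univ : Finset (Fin N)).powersetCard k, nonnegKernelOff K) :=
        measureReal_mono (compl_nonnegUniqueness_subset hk) (measure_ne_top _ _)
    _ ≤ ∑ K ∈ (Finset.univ : Finset (Fin N)).powersetCard k, μ.real (nonnegKernelOff K) :=
        measureReal_biUnion_finset_le _ _
    _ ≤ _ := Finset.sum_le_card_nsmul _ _ _ hK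
    _ = _ := by simp [Finset.card_powersetCard]

lemma sum_choose_mul_le_one {q : ℝ} (hq0 : 0 ≤ q) (hq : q ≤ 1 / 2) {d M : ℕ} (hd : d ≤ M) :
    (∑ i ∈ Finset.range (d + 1), (M.choose i : ℝ)) * (q ^ d * (1 - q) ^ (M - d)) ≤ 1 := by
  have hq1 : 0 ≤ 1 - q := by linarith
  calc (∑ i ∈ Finset.range (d + 1), (M.choose i : ℝ)) * (q ^ d * (1 - q) ^ (M - d))
      ≤ ∑ i ∈ Finset.range (d + 1), q ^ i * (1 - q) ^ (M - i) * M.choose i := by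
        rw [Finset.sum_mul]
        refine Finset.sum_le_sum fun i hi => ?_
        have hid : i ≤ d := Nat.lt_succ_iff.1 (Finset.mem_range.1 hi)
        rw [mul_comm]
        refine mul_le_mul_of_nonneg_right ?_ (Nat.cast_nonneg _)
        rw [show M - i = (d - i) + (M - d) by omega, pow_add, ← mul_assoc,
          ← pow_mul_pow_sub q hid]
        gcongr
        linarith
    _ ≤ ∑ i ∈ Finset.range (M + 1), q ^ i * (1 - q) ^ (M - i) * M.choose i := by
        refine Finset.sum_le_sum_of_subset_of_nonneg
          (Finset.range_mono (by omega)) fun i _ _ => by positivity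
    _ = 1 := by rw [← add_pow, add_sub_cancel, one_pow]

lemma choose_mul_le_one {p : ℝ} (hp0 : 0 ≤ p) (hp : p ≤ 1) {k N : ℕ} (hk : k ≤ N) :
    (N.choose k : ℝ) * (p ^ k * (1 - p) ^ (N - k)) ≤ 1 := by
  have hp1 : 0 ≤ 1 - p := by linarith
  calc (N.choose k : ℝ) * (p ^ k * (1 - p) ^ (N - k))
      = p ^ k * (1 - p) ^ (N - k) * N.choose k := mul_comm _ _
    _ ≤ ∑ i ∈ Finset.range (N + 1), p ^ i * (1 - p) ^ (N - i) * N.choose i :=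
        Finset.single_le_sum (f := fun i => p ^ i * (1 - p) ^ (N - i) * (N.choose i : ℝ))
          (fun i _ => by positivity) (Finset.mem_range.2 (by omega))
    _ = 1 := by rw [← add_pow, add_sub_cancel, one_pow]

/-- Exponential rate bounding the union bound, with `κ = k / N`, `ν = n / N`. -/
noncomputable def unionRate (p q κ ν : ℝ) : ℝ :=
  -(κ * Real.log p + (1 - κ) * Real.log (1 - p) + (1 - ν) * Real.log q +
    (ν - κ) * Real.log (1 - q) + (1 - κ) * Real.log 2)

lemma union_bound_le_exp {p q : ℝ} (hp0 : 0 < p) (hp : p < 1) (hq0 : 0 < q) (hq : q ≤ 1 / 2)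
    {k n N : ℕ} (hk : k ≤ n) (hn : n ≤ N) (hN : 0 < N) :
    (N.choose k : ℝ) *
      ((∑ i ∈ Finset.range (N - n + 1), ((N - k).choose i : ℝ)) / 2 ^ (N - k)) ≤
      Real.exp (N * unionRate p q (k / N) (n / N)) := by
  have hp1 : 0 < 1 - p := by linarith
  have hq1 : 0 < 1 - q := by linarith
  have hN' : (N : ℝ) ≠ 0 := by positivity
  have h1 := choose_mul_le_one hp0.le hp.le (hk.trans hn)
  have h2 := sum_choose_mul_le_one hq0.le hq (show N - n ≤ N - k by omega)
  rw [show N - k - (N - n) = n - k by omega] at h2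
  rw [← le_div_iff₀ (by positivity)] at h1 h2
  have hexp : ∀ {x : ℝ}, 0 < x → ∀ m : ℕ, Real.exp (m * Real.log x) = x ^ m := fun hx m => by
    rw [Real.exp_nat_mul, Real.exp_log hx]
  have hrate : Real.exp (N * unionRate p q (k / N) (n / N)) =
      1 / (p ^ k * (1 - p) ^ (N - k)) * (1 / (q ^ (N - n) * (1 - q) ^ (n - k)) / 2 ^ (N - k)) := by
    rw [← hexp hp0, ← hexp hp1, ← hexp hq0, ← hexp hq1, ← hexp (two_pos : (0 : ℝ) < 2),
      ← Real.exp_add, ← Real.exp_add, one_div, one_div, ← Real.exp_neg, ← Real.exp_neg,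
      ← Real.exp_sub, ← Real.exp_add]
    congr 1
    rw [Nat.cast_sub (hk.trans hn), Nat.cast_sub hn, Nat.cast_sub hk]
    unfold unionRate
    field_simp
    ring
  rw [hrate]
  gcongr

lemma unionRate_eq_psiS {δ ρ : ℝ} (hδ0 : 0 < δ) (hδ1 : δ < 1) (hρ0 : 0 < ρ) (hρ1 : ρ < 1) :
    unionRate (ρ * δ) ((1 - δ) / (1 - ρ * δ)) (ρ * δ) δ = psiS δ ρ := by
  have h1 : 0 < 1 - ρ * δ := by nlinarith
  have h2 : 1 - (1 - δ) / (1 - ρ * δ) = δ * (1 - ρ) / (1 - ρ * δ) := by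
    rw [eq_div_iff h1.ne', sub_mul, div_mul_cancel₀ _ h1.ne']
    ring
  have h3 : 1 - δ ≠ 0 := by linarith
  have h4 : 1 - ρ ≠ 0 := by linarith
  rw [unionRate, psiS, shannonH, shannonH, h2, Real.log_div h3 h1.ne',
    Real.log_div (mul_ne_zero hδ0.ne' h4) h1.ne', Real.log_mul hδ0.ne' h4,
    Real.log_mul hρ0.ne' hδ0.ne']
  ring

/-- **Strong threshold for the orthant.** Below the strong threshold
(`ρ < 2 - δ⁻¹` and `ψ_S(δ,ρ) < 0`), with probability tending to `1` every
nonnegative `k_n`-sparse vector is the unique nonnegative solution of the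
corresponding underdetermined system. -/
theorem strong_threshold_orthant (δ ρ : ℝ)
    (hδ0 : 1 / 2 < δ) (hδ1 : δ < 1) (hρ0 : 0 < ρ) (hρ1 : ρ < 1)
    (hρ : ρ < 2 - δ⁻¹) (hψ : psiS δ ρ < 0)
    (k Nn : ℕ → ℕ)
    (hseq : ∀ n : ℕ, 2 ≤ n → 0 < k n ∧ k n < n ∧ n < Nn n)
    (hk : Tendsto (fun n : ℕ => (k n : ℝ) / n) atTop (nhds ρ))
    (hN : Tendsto (fun n : ℕ => (n : ℝ) / Nn n) atTop (nhds δ))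
    (μ : (n : ℕ) → Measure (Matrix (Fin n) (Fin (Nn n)) ℝ))
    [∀ n, IsProbabilityMeasure (μ n)]
    (hμ : ∀ n : ℕ, 2 ≤ n → OrthantSymmetricGeneric (μ n)) :
    Tendsto (fun n : ℕ =>
        (μ n {A | ∀ x0 : Fin (Nn n) → ℝ, (∀ i, 0 ≤ x0 i) →
          {i | x0 i ≠ 0}.ncard ≤ k n →
            ∀ x : Fin (Nn n) → ℝ, (∀ i, 0 ≤ x i) →
              A.mulVec x = A.mulVec x0 → x = x0}).toReal)
      atTop (nhds 1) := by
  have hδpos : 0 < δ := by linarith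
  have hρδ : ρ * δ < 2 * δ - 1 := by
    have := mul_lt_mul_of_pos_right hρ hδpos
    rwa [sub_mul, inv_mul_cancel₀ hδpos.ne'] at this
  have hp1 : ρ * δ < 1 := by linarith
  have hq0 : 0 < (1 - δ) / (1 - ρ * δ) := div_pos (by linarith) (by linarith)
  have hq : (1 - δ) / (1 - ρ * δ) ≤ 1 / 2 := by
    rw [div_le_div_iff₀ (by linarith) two_pos]
    linarith
  have hκ : Tendsto (fun n : ℕ => (k n : ℝ) / Nn n) atTop (nhds (ρ * δ)) := by
    refine (hk.mul hN).congr' ?_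
    filter_upwards [eventually_gt_atTop 0] with n hn
    have : (n : ℝ) ≠ 0 := by positivity
    field_simp
  have hrate : Tendsto (fun n : ℕ => unionRate (ρ * δ) ((1 - δ) / (1 - ρ * δ))
      (k n / Nn n) (n / Nn n)) atTop (nhds (psiS δ ρ)) := by
    rw [← unionRate_eq_psiS hδpos hδ1 hρ0 hρ1]
    unfold unionRate
    exact ((((hκ.mul_const _).add ((hκ.const_sub 1).mul_const _)).add
      ((hN.const_sub 1).mul_const _)).add ((hN.sub hκ).mul_const _)).add
      ((hκ.const_sub 1).mul_const _) |>.neg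
  have hNn : Tendsto (fun n : ℕ => (Nn n : ℝ)) atTop atTop := by
    refine tendsto_atTop_mono' atTop ?_ tendsto_natCast_atTop_atTop
    filter_upwards [eventually_ge_atTop 2] with n hn
    exact_mod_cast (hseq n hn).2.2.le
  have hexp := Real.tendsto_exp_atBot.comp (hNn.atTop_mul_neg hψ hrate)
  have hlower : Tendsto (fun n : ℕ => 1 - Real.exp (Nn n * unionRate (ρ * δ)
      ((1 - δ) / (1 - ρ * δ)) (k n / Nn n) (n / Nn n))) atTop (nhds 1) := by
    simpa using hexp.const_sub 1
  refine tendsto_of_tendsto_of_tendsto_of_le_of_le' hlower tendsto_const_nhds ?_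
    (Eventually.of_forall fun n => measureReal_le_one)
  filter_upwards [eventually_ge_atTop 2] with n hn
  obtain ⟨-, hkn, hnN⟩ := hseq n hn
  have hcompl := ((hμ n hn).measure_compl_nonnegUniqueness_le (hkn.le.trans hnN.le) hnN.le).trans
    (union_bound_le_exp (mul_pos hρ0 hδpos) hp1 hq0 hq hkn.le hnN.le (by omega))
  have hone : 1 ≤ (μ n).real (nonnegUniqueness n (Nn n) (k n)) +
      (μ n).real (nonnegUniqueness n (Nn n) (k n))ᶜ := by
    have := measureReal_union_le (μ := μ n) (nonnegUniqueness n (Nn n) (k n))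
      (nonnegUniqueness n (Nn n) (k n))ᶜ
    rwa [Set.union_compl_self, probReal_univ] at this
  change _ ≤ (μ n).real (nonnegUniqueness n (Nn n) (k n))
  linarith
end

section
/- Highpass vectors have many negative entries. Let N > n be positive integers with n = 2m+1 odd, m ≥ 1, and let Ω be the n×N low-frequency partial Fourier matrix defined by Ω_{ij} = cos(π(j−1)(i−1)/N) for odd row indices i ∈ {1,3,5,…,n} and Ω_{ij} = sin(π(j−1)i/N) for even row indices i ∈ {2,4,…,n−1}, where 1 ≤ j ≤ N. Then every nonzero vector v ∈ ℝ^N with Ωv = 0 has at least m strictly negative entries. -/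
/-- The `n × N` low-frequency partial Fourier matrix (rows and columns indexed
from `0`, so row `i` here corresponds to row `i + 1` of the paper and column `j`
to column `j + 1`): `Ω_{ij} = cos(π j i / N)` when `i + 1` is odd (i.e. `i` even)
and `Ω_{ij} = sin(π j (i+1) / N)` when `i + 1` is even (i.e. `i` odd). -/
noncomputable def partialFourier (n N : ℕ) : Matrix (Fin n) (Fin N) ℝ :=
  fun i j =>
    if Even i.val then
      Real.cos (Real.pi * j.val * i.val / N)
    else
      Real.sin (Real.pi * j.val * (i.val + 1) / N)

theorem partialFourier_ker_cos {m N : ℕ} {v : Fin N → ℝ}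
    (hker : (partialFourier (2 * m + 1) N).mulVec v = 0) {k : ℕ} (hk : k ≤ m) :
    ∑ j, v j * Real.cos (k * (2 * Real.pi * j.val / N)) = 0 := by
  have h := congrFun hker ⟨2 * k, by omega⟩
  simp only [Matrix.mulVec, dotProduct, partialFourier, even_two_mul, if_true,
    Pi.zero_apply] at h
  rw [← h]
  refine Finset.sum_congr rfl fun j _ => ?_
  rw [mul_comm]
  congr 2
  push_cast
  ring

theorem partialFourier_ker_sin {m N : ℕ} {v : Fin N → ℝ}
    (hker : (partialFourier (2 * m + 1) N).mulVec v = 0) {k : ℕ} (hk : k ≤ m) :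
    ∑ j, v j * Real.sin (k * (2 * Real.pi * j.val / N)) = 0 := by
  rcases k with _ | k
  · simp
  have h := congrFun hker ⟨2 * k + 1, by omega⟩
  have hodd : ¬ Even (2 * k + 1) := by simp
  simp only [Matrix.mulVec, dotProduct, partialFourier, hodd, if_false,
    Pi.zero_apply] at h
  rw [← h]
  refine Finset.sum_congr rfl fun j _ => ?_
  rw [mul_comm]
  congr 2
  push_cast
  ring

theorem partialFourier_ker_cos_add {m N : ℕ} {v : Fin N → ℝ}
    (hker : (partialFourier (2 * m + 1) N).mulVec v = 0) {k : ℤ} (hk : k.natAbs ≤ m) (c : ℝ) :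
    ∑ j, v j * Real.cos (k * (2 * Real.pi * j.val / N) + c) = 0 := by
  have hnat (n : ℕ) (hn : n ≤ m) (c : ℝ) :
      ∑ j, v j * Real.cos (n * (2 * Real.pi * j.val / N) + c) = 0 := by
    have : ∀ j : Fin N, v j * Real.cos (n * (2 * Real.pi * j.val / N) + c) =
        v j * Real.cos (n * (2 * Real.pi * j.val / N)) * Real.cos c -
          v j * Real.sin (n * (2 * Real.pi * j.val / N)) * Real.sin c := fun j => by
      rw [Real.cos_add]; ring
    simp only [this, Finset.sum_sub_distrib, ← Finset.sum_mul,
      partialFourier_ker_cos hker hn, partialFourier_ker_sin hker hn]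
    simp
  obtain ⟨n, rfl | rfl⟩ := k.eq_nat_or_neg
  · exact_mod_cast hnat n (by simpa using hk) c
  · rw [← hnat n (by simpa using hk) (-c)]
    refine Finset.sum_congr rfl fun j _ => ?_
    rw [← Real.cos_neg]
    congr 2
    push_cast
    ring

/-- A vector in the kernel is orthogonal to every trigonometric polynomial of degree at most `m`
of the form `cos (k θ + c) * ∏ s ∈ S, (1 - cos (θ - t s))`. -/
theorem partialFourier_ker_prod {m N : ℕ} {v : Fin N → ℝ}
    (hker : (partialFourier (2 * m + 1) N).mulVec v = 0) {ι : Type*} (t : ι → ℝ)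
    (S : Finset ι) (k : ℤ) (hk : k.natAbs + S.card ≤ m) (c : ℝ) :
    ∑ j, v j * (Real.cos (k * (2 * Real.pi * j.val / N) + c) *
      ∏ s ∈ S, (1 - Real.cos (2 * Real.pi * j.val / N - t s))) = 0 := by
  classical
  induction S using Finset.induction_on generalizing k c with
  | empty => simpa using partialFourier_ker_cos_add hker (by simpa using hk) c
  | insert a S ha ih =>
    rw [Finset.card_insert_of_notMem ha] at hk
    have h0 := ih k (by omega) c
    have h1 := ih (k + 1) (by omega) (c - t a)
    have h2 := ih (k - 1) (by omega) (c + t a)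
    have key : ∀ x : ℝ, Real.cos (k * x + c) * (1 - Real.cos (x - t a)) =
        Real.cos (k * x + c) - Real.cos ((k + 1 : ℤ) * x + (c - t a)) / 2 -
          Real.cos ((k - 1 : ℤ) * x + (c + t a)) / 2 := fun x => by
      have e1 : ((k + 1 : ℤ) : ℝ) * x + (c - t a) = (k * x + c) + (x - t a) := by
        push_cast; ring
      have e2 : ((k - 1 : ℤ) : ℝ) * x + (c + t a) = (k * x + c) - (x - t a) := by
        push_cast; ring
      rw [e1, e2, Real.cos_add (k * x + c), Real.cos_sub (k * x + c)]
      ring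
    simp only [Finset.prod_insert ha, ← mul_assoc (Real.cos _), key]
    have hsum : ∀ A B C : Fin N → ℝ, ∑ j, A j = 0 → ∑ j, B j = 0 → ∑ j, C j = 0 →
        ∑ j, (A j - B j / 2 - C j / 2) = 0 := fun A B C hA hB hC => by
      simp [Finset.sum_sub_distrib, ← Finset.sum_div, hA, hB, hC]
    rw [← hsum _ _ _ h0 h1 h2]
    refine Finset.sum_congr rfl fun j _ => ?_
    ring

theorem cos_grid_sub_lt_one {N : ℕ} {i j : Fin N} (hij : i ≠ j) :
    Real.cos (2 * Real.pi * i.val / N - 2 * Real.pi * j.val / N) < 1 := by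
  have hN : (0 : ℝ) < N := by exact_mod_cast i.pos
  have hi : (i.val : ℝ) < N := by exact_mod_cast i.isLt
  have hj : (j.val : ℝ) < N := by exact_mod_cast j.isLt
  have hi0 : (0 : ℝ) ≤ i.val := Nat.cast_nonneg _
  have hj0 : (0 : ℝ) ≤ j.val := Nat.cast_nonneg _
  have hpi := Real.pi_pos
  refine lt_of_le_of_ne (Real.cos_le_one _) fun h => hij ?_
  have e : 2 * Real.pi * i.val / N - 2 * Real.pi * j.val / N =
      2 * Real.pi * (((i.val : ℝ) - j.val) / N) := by ring
  have hlo : -1 < ((i.val : ℝ) - j.val) / N := by rw [lt_div_iff₀ hN]; linarith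
  have hhi : ((i.val : ℝ) - j.val) / N < 1 := by rw [div_lt_iff₀ hN]; linarith
  rw [e, Real.cos_eq_one_iff_of_lt_of_lt (by nlinarith) (by nlinarith)] at h
  have h' : (i.val : ℝ) - j.val = 0 := by
    simpa [hpi.ne', hN.ne'] using h
  exact Fin.ext (by exact_mod_cast sub_eq_zero.mp h')

/-- **Highpass vectors have many negative entries.** Every nonzero vector in the
kernel of the `(2m+1) × N` low-frequency partial Fourier matrix has at least `m`
strictly negative entries. -/
theorem highpass_many_negative_entries (m N : ℕ) (hm : 1 ≤ m) (hN : 2 * m + 1 < N)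
    (v : Fin N → ℝ) (hv : v ≠ 0)
    (hker : (partialFourier (2 * m + 1) N).mulVec v = 0) :
    m ≤ {i | v i < 0}.ncard := by
  classical
  by_contra! hlt
  set S : Finset (Fin N) := Finset.univ.filter fun i => v i < 0 with hS
  have hcard : S.card < m := by
    rwa [← Set.ncard_coe_finset, hS, Finset.coe_filter_univ]
  have hmem : ∀ i, i ∈ S ↔ v i < 0 := by simp [hS]
  have hsum := partialFourier_ker_prod hker (fun s : Fin N => 2 * Real.pi * s.val / N) S 0
    (by simpa using hcard.le) 0
  have hone : ∑ j, v j = 0 := by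
    simpa using partialFourier_ker_prod hker (fun s : Fin N => (0 : ℝ)) ∅ 0 (by simp) 0
  simp only [Int.cast_zero, zero_mul, add_zero, Real.cos_zero, one_mul] at hsum
  have hterm : ∀ j ∈ Finset.univ, 0 ≤ v j *
      ∏ s ∈ S, (1 - Real.cos (2 * Real.pi * j.val / N - 2 * Real.pi * s.val / N)) := by
    intro j _
    by_cases hj : j ∈ S
    · rw [Finset.prod_eq_zero hj (by simp), mul_zero]
    · exact mul_nonneg (not_lt.mp (mt (hmem j).mpr hj))
        (Finset.prod_nonneg fun s _ => sub_nonneg.mpr (Real.cos_le_one _))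
  have hzero := (Finset.sum_eq_zero_iff_of_nonneg hterm).mp hsum
  have hnonpos : ∀ j ∈ Finset.univ, v j ≤ 0 := by
    intro j hj
    by_cases hjS : j ∈ S
    · exact ((hmem j).mp hjS).le
    · refine ((mul_eq_zero.mp (hzero j hj)).resolve_right ?_).le
      refine (Finset.prod_pos fun s hs => sub_pos.mpr (cos_grid_sub_lt_one ?_)).ne'
      rintro rfl
      exact hjS hs
  exact hv (funext fun j =>
    (Finset.sum_eq_zero_iff_of_nonpos hnonpos).mp hone j (Finset.mem_univ j))
end

section
/- Sparse nonnegative recovery with the low-frequency partial Fourier matrix. Let N > n be positive integers with n = 2m+1 odd, m ≥ 1, and let Ω be the n×N low-frequency partial Fourier matrix defined by Ω_{ij} = cos(π(j−1)(i−1)/N) for odd row indices i ∈ {1,3,5,…,n} and Ω_{ij} = sin(π(j−1)i/N) for even row indices i ∈ {2,4,…,n−1}, where 1 ≤ j ≤ N. Then for every x_0 ∈ ℝ^N with x_0 ≥ 0 coordinatewise having fewer than m nonzero entries, the only x ∈ ℝ^N with x ≥ 0 coordinatewise and Ωx = Ωx_0 is x = x_0. -/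
open Polynomial ComplexConjugate

/-- Vanishing moments up to degree `m` annihilate every polynomial of degree at most `m`. -/
theorem sum_mul_eval_eq_zero_of_moments {ι R : Type*} [CommSemiring R] (s : Finset ι)
    (w z : ι → R) (m : ℕ) (h : ∀ k ≤ m, ∑ j ∈ s, w j * z j ^ k = 0) (p : R[X])
    (hp : p.natDegree ≤ m) : ∑ j ∈ s, w j * p.eval (z j) = 0 := by
  simp_rw [eval_eq_sum_range, Finset.mul_sum]
  rw [Finset.sum_comm]
  refine Finset.sum_eq_zero fun k hk => ?_
  have hkm : k ≤ m := (Nat.lt_succ_iff.mp (Finset.mem_range.mp hk)).trans hp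
  have hmul : ∑ j ∈ s, p.coeff k * (w j * z j ^ k) = 0 := by
    rw [← Finset.mul_sum, h k hkm, mul_zero]
  rw [← hmul]
  exact Finset.sum_congr rfl fun j _ => by ring

/-- A real weight on the unit circle whose moments vanish up to degree `m` annihilates
`‖p‖ ^ 2` for every polynomial `p` of degree at most `m`. -/
theorem sum_mul_normSq_eval_eq_zero {ι : Type*} (s : Finset ι) (d : ι → ℝ) (z : ι → ℂ)
    (hz : ∀ j, z j * conj (z j) = 1) (m : ℕ)
    (h : ∀ k ≤ m, ∑ j ∈ s, (d j : ℂ) * z j ^ k = 0) (p : ℂ[X]) (hp : p.natDegree ≤ m) :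
    ∑ j ∈ s, d j * Complex.normSq (p.eval (z j)) = 0 := by
  have hconj : ∀ k ≤ m, ∑ j ∈ s, (d j : ℂ) * conj (z j) ^ k = 0 := fun k hk => by
    simpa using congrArg conj (h k hk)
  have hmixed : ∀ b ≤ m, ∀ a ≤ m, ∑ j ∈ s, ((d j : ℂ) * conj (z j) ^ b) * z j ^ a = 0 := by
    intro b hb a ha
    rcases le_total a b with hab | hab
    · obtain ⟨c, rfl⟩ := Nat.exists_eq_add_of_le hab
      rw [← hconj c (by omega)]
      refine Finset.sum_congr rfl fun j _ => ?_
      calc _ = (d j : ℂ) * conj (z j) ^ c * (z j * conj (z j)) ^ a := by ring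
        _ = _ := by rw [hz, one_pow, mul_one]
    · obtain ⟨c, rfl⟩ := Nat.exists_eq_add_of_le hab
      rw [← h c (by omega)]
      refine Finset.sum_congr rfl fun j _ => ?_
      calc _ = (d j : ℂ) * z j ^ c * (z j * conj (z j)) ^ b := by ring
        _ = _ := by rw [hz, one_pow, mul_one]
  have hleft : ∀ a ≤ m, ∑ j ∈ s, ((d j : ℂ) * conj (p.eval (z j))) * z j ^ a = 0 := by
    intro a ha
    have hsum := congrArg conj (sum_mul_eval_eq_zero_of_moments s _ z m (hmixed a ha) p hp)
    simp only [map_sum, map_mul, map_pow, Complex.conj_conj, Complex.conj_ofReal, map_zero]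
      at hsum
    rw [← hsum]
    exact Finset.sum_congr rfl fun j _ => by ring
  have hsum := sum_mul_eval_eq_zero_of_moments s _ z m hleft p hp
  have hcast : ((∑ j ∈ s, d j * Complex.normSq (p.eval (z j)) : ℝ) : ℂ) = 0 := by
    rw [← hsum]
    push_cast
    refine Finset.sum_congr rfl fun j _ => ?_
    rw [← Complex.mul_conj]
    ring
  exact_mod_cast hcast

/-- A real weight at distinct points of the unit circle that is nonnegative off a set of
fewer than `m + 1` points and whose moments vanish up to degree `m` is zero. -/
theorem weight_eq_zero_of_moments {ι : Type*} [Fintype ι] [DecidableEq ι] (d : ι → ℝ)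
    (z : ι → ℂ) (hz : ∀ j, z j * conj (z j) = 1) (hinj : Function.Injective z) (m : ℕ)
    (h : ∀ k ≤ m, ∑ j, (d j : ℂ) * z j ^ k = 0) (S : Finset ι) (hS : S.card ≤ m)
    (hd : ∀ j ∉ S, 0 ≤ d j) : d = 0 := by
  have hdeg : ∀ T : Finset ι, (∏ t ∈ T, (X - C (z t))).natDegree = T.card := fun T => by
    rw [natDegree_prod_of_monic _ _ fun t _ => monic_X_sub_C _]
    simp
  have heval : ∀ (T : Finset ι) (j : ι), (∏ t ∈ T, (X - C (z t))).eval (z j) = 0 ↔ j ∈ T := by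
    intro T j
    simp [eval_prod, Finset.prod_eq_zero_iff, sub_eq_zero, hinj.eq_iff]
  have hoff : ∀ j ∉ S, d j = 0 := by
    intro j hj
    have hsum := sum_mul_normSq_eval_eq_zero Finset.univ d z hz m h
      (∏ t ∈ S, (X - C (z t))) ((hdeg S).trans_le hS)
    rw [Finset.sum_eq_zero_iff_of_nonneg] at hsum
    · have hmul := hsum j (Finset.mem_univ j)
      rw [mul_eq_zero, Complex.normSq_eq_zero, heval] at hmul
      exact hmul.resolve_right hj
    · intro i _
      by_cases hi : i ∈ S
      · rw [(heval S i).mpr hi]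
        simp
      · exact mul_nonneg (hd i hi) (Complex.normSq_nonneg _)
  funext s
  by_cases hs : s ∈ S
  · have hsum := sum_mul_eval_eq_zero_of_moments Finset.univ _ z m h
      (∏ t ∈ S.erase s, (X - C (z t)))
      ((hdeg _).trans_le ((Finset.card_erase_le).trans hS))
    rw [Finset.sum_eq_single s] at hsum
    · rw [mul_eq_zero, heval] at hsum
      simpa using hsum
    · intro j _ hjs
      by_cases hj : j ∈ S
      · rw [(heval _ j).mpr (Finset.mem_erase.mpr ⟨hjs, hj⟩), mul_zero]
      · simp [hoff j hj]
    · simp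
  · exact hoff s hs

/-- A vector in the kernel of the low-frequency partial Fourier matrix, seen as a weight on
the `N`-th roots of unity, has vanishing moments up to degree `m`. -/
theorem moments_eq_zero_of_partialFourier_mulVec_eq_zero {m N : ℕ} (d : Fin N → ℝ)
    (hd : (partialFourier (2 * m + 1) N).mulVec d = 0) (k : ℕ) (hk : k ≤ m) :
    ∑ j : Fin N, (d j : ℂ) * (Complex.exp (2 * Real.pi * Complex.I / N) ^ j.val) ^ k = 0 := by
  have hexp : ∀ j : Fin N, (Complex.exp (2 * Real.pi * Complex.I / N) ^ j.val) ^ k =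
      Complex.exp ((2 * Real.pi * j.val * k / N : ℝ) * Complex.I) := by
    intro j
    rw [← Complex.exp_nat_mul, ← Complex.exp_nat_mul]
    congr 1
    push_cast
    ring
  have hcos : ∑ j : Fin N, d j * Real.cos (2 * Real.pi * j.val * k / N) = 0 := by
    rw [← show _ = (0 : ℝ) from congrFun hd ⟨2 * k, by omega⟩]
    refine Finset.sum_congr rfl fun j _ => ?_
    simp only [partialFourier, even_two_mul, if_true]
    rw [mul_comm]
    congr 2
    push_cast
    ring
  have hsin : ∑ j : Fin N, d j * Real.sin (2 * Real.pi * j.val * k / N) = 0 := by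
    rcases k with _ | k
    · simp
    rw [← show _ = (0 : ℝ) from congrFun hd ⟨2 * k + 1, by omega⟩]
    refine Finset.sum_congr rfl fun j _ => ?_
    have hodd : ¬ Even (2 * k + 1) := by simp
    simp only [partialFourier, hodd, if_false]
    rw [mul_comm]
    congr 2
    push_cast
    ring
  simp_rw [hexp]
  apply Complex.ext
  · simpa [Complex.re_sum, Complex.exp_ofReal_mul_I_re, -Complex.ofReal_div,
      -Complex.ofReal_mul] using hcos
  · simpa [Complex.im_sum, Complex.exp_ofReal_mul_I_im, -Complex.ofReal_div,
      -Complex.ofReal_mul] using hsin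


/-- **Sparse nonnegative recovery with the low-frequency partial Fourier matrix.**
For the `(2m+1) × N` low-frequency partial Fourier matrix `Ω`, every nonnegative
vector `x₀` with fewer than `m` nonzeros is the unique nonnegative solution of
`Ωx = Ωx₀`. -/
theorem partialFourier_sparse_recovery (m N : ℕ) (hm : 1 ≤ m) (hN : 2 * m + 1 < N)
    (x0 : Fin N → ℝ) (hx0 : ∀ i, 0 ≤ x0 i)
    (hx0k : {i | x0 i ≠ 0}.ncard < m) :
    ∀ x : Fin N → ℝ, (∀ i, 0 ≤ x i) →
      (partialFourier (2 * m + 1) N).mulVec x =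
        (partialFourier (2 * m + 1) N).mulVec x0 → x = x0 := by
  intro x hx hxx0
  have hN0 : N ≠ 0 := by omega
  have hroot := Complex.isPrimitiveRoot_exp N hN0
  refine sub_eq_zero.mp (weight_eq_zero_of_moments (x - x0)
    (fun j => Complex.exp (2 * Real.pi * Complex.I / N) ^ j.val) ?_ ?_ m
    (moments_eq_zero_of_partialFourier_mulVec_eq_zero (x - x0) ?_)
    (Finset.univ.filter fun i => x0 i ≠ 0) ?_ ?_)
  · intro j
    rw [Complex.mul_conj, Complex.normSq_eq_norm_sq, norm_pow, hroot.norm'_eq_one hN0]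
    simp
  · intro i j hij
    exact Fin.ext (hroot.pow_inj i.isLt j.isLt hij)
  · rw [Matrix.mulVec_sub, hxx0, sub_self]
  · rw [← Set.ncard_coe_finset]
    simpa using hx0k.le
  · intro j hj
    have hj0 : x0 j = 0 := by simpa using hj
    simpa [hj0] using hx j
end

section
/- Sign of the weak exponent at and below the threshold curve. Let δ ∈ (1/2, 1). Then ψ_W(δ, 2 − δ^{-1}) = 0, and for every ρ with 0 < ρ < 2 − δ^{-1} one has ψ_W(δ, ρ) < 0. -/
/-- The weak exponent `ψ_W(δ,ρ) = H(δ) + δ H(ρ) - H(ρδ) - (1 - ρδ) log 2`. -/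
noncomputable def psiW (δ ρ : ℝ) : ℝ :=
  shannonH δ + δ * shannonH ρ - shannonH (ρ * δ) - (1 - ρ * δ) * Real.log 2

theorem shannonH_eq_binEntropy (γ : ℝ) : shannonH γ = Real.binEntropy γ := by
  simp only [shannonH, Real.binEntropy, Real.log_inv]
  ring

/-- Chain rule for entropy: `ψ_W` is a positive multiple of the entropy deficit at
`(1 - δ) / (1 - ρδ)`. -/
theorem psiW_eq_mul_entropy_sub_log_two {δ ρ : ℝ} (hδ0 : 0 < δ) (hδ1 : δ < 1)
    (hρ0 : 0 < ρ) (hρ1 : ρ < 1) :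
    psiW δ ρ = (1 - ρ * δ) * (shannonH ((1 - δ) / (1 - ρ * δ)) - Real.log 2) := by
  have h : 0 < 1 - ρ * δ := by nlinarith
  have hδ : 0 < 1 - δ := by linarith
  have hρ : 0 < 1 - ρ := by linarith
  have hx : 1 - (1 - δ) / (1 - ρ * δ) = δ * (1 - ρ) / (1 - ρ * δ) := by
    rw [eq_div_iff h.ne', sub_mul, div_mul_cancel₀ _ h.ne']
    ring
  simp only [psiW, shannonH]
  rw [hx, Real.log_div hδ.ne' h.ne', Real.log_div (by positivity) h.ne',
    Real.log_mul hδ0.ne' hρ.ne', Real.log_mul hρ0.ne' hδ0.ne']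
  have e₁ : (1 - ρ * δ) * ((1 - δ) / (1 - ρ * δ)) = 1 - δ := by
    rw [mul_div_assoc', mul_div_cancel_left₀ _ h.ne']
  have e₂ : (1 - ρ * δ) * (δ * (1 - ρ) / (1 - ρ * δ)) = δ * (1 - ρ) := by
    rw [mul_div_assoc', mul_div_cancel_left₀ _ h.ne']
  linear_combination (Real.log (1 - δ) - Real.log (1 - ρ * δ)) * e₁ +
    (Real.log δ + Real.log (1 - ρ) - Real.log (1 - ρ * δ)) * e₂

/-- **Sign of the weak exponent at and below the threshold curve.** For
`δ ∈ (1/2, 1)`, `ψ_W(δ, 2 - δ⁻¹) = 0`, and `ψ_W(δ, ρ) < 0` for all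
`0 < ρ < 2 - δ⁻¹`. -/
theorem psiW_sign (δ : ℝ) (hδ0 : 1 / 2 < δ) (hδ1 : δ < 1) :
    psiW δ (2 - δ⁻¹) = 0 ∧
      ∀ ρ : ℝ, 0 < ρ → ρ < 2 - δ⁻¹ → psiW δ ρ < 0 := by
  have hδ : 0 < δ := by linarith
  have hmul : (2 - δ⁻¹) * δ = 2 * δ - 1 := by field_simp
  have hpos : 0 < 2 - δ⁻¹ := by
    by_contra! hle
    nlinarith
  have hlt : 2 - δ⁻¹ < 1 := by
    linarith [(one_lt_inv₀ hδ).2 hδ1]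
  constructor
  · have hx : (1 - δ) / (1 - (2 - δ⁻¹) * δ) = 2⁻¹ := by
      have : 1 - δ ≠ 0 := by linarith
      rw [hmul, show 1 - (2 * δ - 1) = 2 * (1 - δ) by ring]
      field_simp
    rw [psiW_eq_mul_entropy_sub_log_two hδ hδ1 hpos hlt, hx, shannonH_eq_binEntropy,
      Real.binEntropy_two_inv, sub_self, mul_zero]
  · intro ρ hρ0 hρ
    have hρδ : ρ * δ < 2 * δ - 1 := hmul ▸ mul_lt_mul_of_pos_right hρ hδ
    have h : 0 < 1 - ρ * δ := by linarith
    rw [psiW_eq_mul_entropy_sub_log_two hδ hδ1 hρ0 (hρ.trans hlt), shannonH_eq_binEntropy]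
    refine mul_neg_of_pos_of_neg h (sub_neg.2 (Real.binEntropy_lt_log_two.2 ?_))
    intro hx
    rw [div_eq_iff h.ne'] at hx
    linarith
end
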